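/- Theorem (efficiency comparison of score functions): let Y = {1,…,K} with K ≥ 2, let (x_{n+1}, y_{n+1}) be a random test pair with label in Y, let C_A(x_{n+1}) ⊆ Y and C_Ã(x_{n+1}) ⊆ Y be two random prediction sets (from score functions A and Ã respectively), and let y_{n+1}^R be a random label that, conditionally on all other randomness, is uniformly distributed on Y∖{y_{n+1}}. Suppose for some α, α_c^A, α_c^Ã ∈ [0,1]: (i) 1 − α ≤ Pr[y_{n+1} ∈ C_A(x_{n+1})] ≤ 1 − α + 1/(n+1) and 1 − α ≤ Pr[y_{n+1} ∈ C_Ã(x_{n+1})] ≤ 1 − α + 1/(n+1); (ii) 1 − α_c^A ≤ Pr[y_{n+1}^R ∈ C_A(x_{n+1})] ≤ 1 − α_c^A + 1/(n+1) and 1 − α_c^Ã ≤ Pr[y_{n+1}^R ∈ C_Ã(x_{n+1})] ≤ 1 − α_c^Ã + 1/(n+1). If α_c^A − α_c^Ã ≥ 2/(n+1), then A produces a more efficient prediction set than Ã in expectation: E[|C_Ã(x_{n+1})| − |C_A(x_{n+1})|] ≥ 0. -/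

import Mathlib

open MeasureTheory

/-- The expectation of a function of a random variable with finitely many values. -/
theorem integral_comp_eq_sum_fiber {Ω S : Type*} [MeasurableSpace Ω] (ℙ : Measure Ω)
    [IsProbabilityMeasure ℙ] [Fintype S] (X : Ω → S)
    (hX : ∀ s, MeasurableSet {ω | X ω = s}) (f : S → ℝ) :
    Integrable (fun ω => f (X ω)) ℙ ∧
      ∫ ω, f (X ω) ∂ℙ = ∑ s, ℙ.real {ω | X ω = s} * f s := by
  let _ : MeasurableSpace S := ⊤
  have hm : Measurable X := measurable_to_countable' hX
  have hf : Integrable f (ℙ.map X) := Integrable.of_finite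
  refine ⟨hf.comp_measurable hm, ?_⟩
  rw [← integral_map hm.aemeasurable hf.aestronglyMeasurable, integral_fintype hf]
  refine Finset.sum_congr rfl fun s _ => ?_
  rw [map_measureReal_apply hm (measurableSet_singleton s), smul_eq_mul]
  rfl

/-- The probability of an event determined by a random variable with finitely many values. -/
theorem measureReal_eq_sum_fiber {Ω S : Type*} [MeasurableSpace Ω] (ℙ : Measure Ω)
    [IsProbabilityMeasure ℙ] [Fintype S] (X : Ω → S)
    (hX : ∀ s, MeasurableSet {ω | X ω = s}) (p : S → Prop) [DecidablePred p] :
    ℙ.real {ω | p (X ω)} = ∑ s, ℙ.real {ω | X ω = s} * if p s then 1 else 0 := by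
  let _ : MeasurableSpace S := ⊤
  have hm : Measurable X := measurable_to_countable' hX
  have hp : MeasurableSet {ω | p (X ω)} := hm (MeasurableSet.of_discrete (s := {s | p s}))
  rw [← (integral_comp_eq_sum_fiber ℙ X hX fun s => if p s then (1 : ℝ) else 0).2,
    ← integral_indicator_one hp]
  simp only [Set.indicator_apply, Set.mem_ofPred_eq, Pi.one_apply]

/-- If `yR` is conditionally uniform on the labels different from `y`, the expected size of a random
set `C` is `Pr[y ∈ C] + (K - 1) Pr[yR ∈ C]`. -/
theorem integral_card_eq_coverage_add {Ω T : Type*} [MeasurableSpace Ω] (ℙ : Measure Ω)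
    [IsProbabilityMeasure ℙ] [Fintype T] {K : ℕ} (hK : 2 ≤ K) (Z : Ω → T) (yR : Ω → Fin K)
    (hZ : ∀ t, MeasurableSet {ω | Z ω = t}) (hyR : ∀ y', MeasurableSet {ω | yR ω = y'})
    (y : T → Fin K) (C : T → Finset (Fin K))
    (hcond : ∀ t y', ℙ.real {ω | Z ω = t ∧ yR ω = y'} =
      (if y' = y t then 0 else ((K : ℝ) - 1)⁻¹) * ℙ.real {ω | Z ω = t}) :
    ∫ ω, ((C (Z ω)).card : ℝ) ∂ℙ =
      ℙ.real {ω | y (Z ω) ∈ C (Z ω)} + ((K : ℝ) - 1) * ℙ.real {ω | yR ω ∈ C (Z ω)} := by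
  have hK' : (K : ℝ) - 1 ≠ 0 := by
    have : (2 : ℝ) ≤ K := by exact_mod_cast hK
    linarith
  have hW : ∀ s : T × Fin K, MeasurableSet {ω | (Z ω, yR ω) = s} := fun s => by
    simpa only [Prod.ext_iff, Set.ofPred_and] using (hZ s.1).inter (hyR s.2)
  rw [(integral_comp_eq_sum_fiber ℙ Z hZ fun t => ((C t).card : ℝ)).2,
    measureReal_eq_sum_fiber ℙ Z hZ fun t => y t ∈ C t,
    measureReal_eq_sum_fiber ℙ (fun ω => (Z ω, yR ω)) hW fun s => s.2 ∈ C s.1,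
    Fintype.sum_prod_type, Finset.mul_sum, ← Finset.sum_add_distrib]
  refine Finset.sum_congr rfl fun t _ => ?_
  simp only [Prod.mk.injEq, hcond, Finset.mul_sum]
  have hsplit : ((C t).card : ℝ) =
      (if y t ∈ C t then 1 else 0) + ∑ y', if y' = y t then 0 else if y' ∈ C t then 1 else 0 := by
    rw [← Fintype.sum_ite_eq' (y t) fun y' => if y' ∈ C t then (1 : ℝ) else 0,
      ← Finset.sum_add_distrib]
    rw [Finset.sum_congr rfl (g := fun y' => if y' ∈ C t then (1 : ℝ) else 0)
      fun y' _ => by split_ifs <;> simp]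
    simp
  rw [hsplit, mul_add, Finset.mul_sum]
  congr 1
  refine Finset.sum_congr rfl fun y' _ => ?_
  split_ifs <;> field_simp <;> simp

/-- **Efficiency comparison of score functions (Theorem 3).**
Let `Y = Fin K` with `K ≥ 2`, `n ≥ 1` the calibration-set size, `y_{n+1}` a random
test label, `C_A(x_{n+1}), C_Ã(x_{n+1}) ⊆ Y` two random prediction sets, and
`y_{n+1}^R` a random label that, conditionally on all other randomness, is uniform on
`Y ∖ {y_{n+1}}`.  Assume correct-label coverage of both sets lies in
`[1-α, 1-α+1/(n+1)]` and random-incorrect-label coverage lies in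
`[1-α_c^A, 1-α_c^A+1/(n+1)]` for `C_A` and `[1-α_c^Ã, 1-α_c^Ã+1/(n+1)]` for `C_Ã`.
If `α_c^A - α_c^Ã ≥ 2/(n+1)`, then `A` is more efficient than `Ã` in expectation:
`E[|C_Ã(x_{n+1})| - |C_A(x_{n+1})|] ≥ 0`. -/
theorem efficiency_comparison
    {Ω : Type*} [MeasurableSpace Ω] (ℙ : Measure Ω) [IsProbabilityMeasure ℙ]
    {K : ℕ} (hK : 2 ≤ K) {n : ℕ} (hn : 1 ≤ n)
    (yTest yR : Ω → Fin K) (CA CT : Ω → Finset (Fin K))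
    (hyT : ∀ yv : Fin K, MeasurableSet {ω | yTest ω = yv})
    (hyR : ∀ y' : Fin K, MeasurableSet {ω | yR ω = y'})
    (hCA : ∀ F : Finset (Fin K), MeasurableSet {ω | CA ω = F})
    (hCT : ∀ F : Finset (Fin K), MeasurableSet {ω | CT ω = F})
    -- conditionally on all other randomness, `yR` is uniform on `Y ∖ {yTest}`:
    (hcond : ∀ (yv y' : Fin K) (F G : Finset (Fin K)),
      ℙ {ω | yTest ω = yv ∧ CA ω = F ∧ CT ω = G ∧ yR ω = y'}
        = (if y' = yv then 0 else (((K - 1 : ℕ) : ENNReal))⁻¹)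
            * ℙ {ω | yTest ω = yv ∧ CA ω = F ∧ CT ω = G})
    (α αcA αcT : ℝ)
    (hα : α ∈ Set.Icc (0 : ℝ) 1) (hαcA : αcA ∈ Set.Icc (0 : ℝ) 1)
    (hαcT : αcT ∈ Set.Icc (0 : ℝ) 1)
    (hcovA₁ : 1 - α ≤ (ℙ {ω | yTest ω ∈ CA ω}).toReal)
    (hcovA₂ : (ℙ {ω | yTest ω ∈ CA ω}).toReal ≤ 1 - α + 1 / ((n : ℝ) + 1))
    (hcovT₁ : 1 - α ≤ (ℙ {ω | yTest ω ∈ CT ω}).toReal)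
    (hcovT₂ : (ℙ {ω | yTest ω ∈ CT ω}).toReal ≤ 1 - α + 1 / ((n : ℝ) + 1))
    (hcovRA₁ : 1 - αcA ≤ (ℙ {ω | yR ω ∈ CA ω}).toReal)
    (hcovRA₂ : (ℙ {ω | yR ω ∈ CA ω}).toReal ≤ 1 - αcA + 1 / ((n : ℝ) + 1))
    (hcovRT₁ : 1 - αcT ≤ (ℙ {ω | yR ω ∈ CT ω}).toReal)
    (hcovRT₂ : (ℙ {ω | yR ω ∈ CT ω}).toReal ≤ 1 - αcT + 1 / ((n : ℝ) + 1))
    (hgap : 2 / ((n : ℝ) + 1) ≤ αcA - αcT) :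
    0 ≤ ∫ ω, (((CT ω).card : ℝ) - ((CA ω).card : ℝ)) ∂ℙ := by
  have hZ : ∀ t : Fin K × Finset (Fin K) × Finset (Fin K),
      MeasurableSet {ω | (yTest ω, CA ω, CT ω) = t} := fun t => by
    simpa only [Prod.ext_iff, Set.ofPred_and] using (hyT t.1).inter ((hCA t.2.1).inter (hCT t.2.2))
  have hcond' : ∀ (t : Fin K × Finset (Fin K) × Finset (Fin K)) (y' : Fin K),
      ℙ.real {ω | (yTest ω, CA ω, CT ω) = t ∧ yR ω = y'} =
        (if y' = t.1 then 0 else ((K : ℝ) - 1)⁻¹) *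
          ℙ.real {ω | (yTest ω, CA ω, CT ω) = t} := by
    rintro ⟨yv, F, G⟩ y'
    have h := congrArg ENNReal.toReal (hcond yv y' F G)
    rw [ENNReal.toReal_mul, apply_ite ENNReal.toReal, ENNReal.toReal_inv, ENNReal.toReal_natCast,
      Nat.cast_sub (by lia), Nat.cast_one, ENNReal.toReal_zero] at h
    simpa only [Measure.real, Prod.mk.injEq, and_assoc] using h
  have hA := integral_card_eq_coverage_add ℙ hK _ yR hZ hyR (fun t => t.1) (fun t => t.2.1) hcond'
  have hT := integral_card_eq_coverage_add ℙ hK _ yR hZ hyR (fun t => t.1) (fun t => t.2.2) hcond'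
  rw [integral_sub (integral_comp_eq_sum_fiber ℙ CT hCT fun F => (F.card : ℝ)).1
    (integral_comp_eq_sum_fiber ℙ CA hCA fun F => (F.card : ℝ)).1, hA, hT]
  simp only [Measure.real]
  have hK' : (2 : ℝ) ≤ K := by exact_mod_cast hK
  have hn' : 0 ≤ 1 / ((n : ℝ) + 1) := by positivity
  have htwo : 2 / ((n : ℝ) + 1) = 2 * (1 / ((n : ℝ) + 1)) := by ring
  have hR : 1 / ((n : ℝ) + 1) ≤
      (ℙ {ω | yR ω ∈ CT ω}).toReal - (ℙ {ω | yR ω ∈ CA ω}).toReal := by linarith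
  nlinarith [mul_nonneg (sub_nonneg.2 hK') (hn'.trans hR)]
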